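/- There exists a constant k > 0 such that for every N ∈ ℕ there exist a finite undirected graph G with n ≥ N vertices and edge set E, a finite commodity set H, a nonempty compact convex demand polytope D ⊆ ℝ_{≥0}^H, and a cost vector λ ∈ ℝ_{≥0}^E, such that 0 < inf_{u ∈ U(D)} Σ_{e∈E} λ(e)·u(e) and inf_{u ∈ U_stat(D)} Σ_{e∈E} λ(e)·u(e) ≥ k · (log n) · inf_{u ∈ U(D)} Σ_{e∈E} λ(e)·u(e). That is, when a linear reservation cost is minimized, the optimal static (oblivious) fractional solution can be Ω(log n) times more expensive than the optimal dynamic fractional solution. -/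

import Mathlib

open scoped BigOperators

/-- Net flow out of vertex `v` for a single-commodity flow `f` on an undirected
graph whose edges `e` have endpoints `src e` and `dst e`; `f e true` is the flow
on `e` oriented from `src e` to `dst e`, `f e false` the flow on the opposite
orientation. -/
def netOut {V E : Type*} [Fintype E] [DecidableEq V]
    (src dst : E → V) (f : E → Bool → ℝ) (v : V) : ℝ :=
  ∑ e, ((if src e = v then f e true - f e false else 0) +
        (if dst e = v then f e false - f e true else 0))

/-- `f` is a routing of the demand vector `d` under the reservation `u`:
each commodity flow is nonnegative, conserved at every vertex other than the
endpoints of the commodity, ships a net flow of `d h` out of `s h`, and the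
total flow (in both directions) on each edge is at most `u e`. -/
def IsRouting {V E H : Type*} [Fintype E] [Fintype H] [DecidableEq V]
    (src dst : E → V) (s t : H → V) (d : H → ℝ) (u : E → ℝ)
    (f : H → E → Bool → ℝ) : Prop :=
  (∀ h e b, 0 ≤ f h e b) ∧
  (∀ h v, v ≠ s h → v ≠ t h → netOut src dst (f h) v = 0) ∧
  (∀ h, netOut src dst (f h) (s h) = d h) ∧
  (∀ e, (∑ h, (f h e true + f h e false)) ≤ u e)

/-- `d` is routable under the reservation `u`. -/
def Routable {V E H : Type*} [Fintype E] [Fintype H] [DecidableEq V]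
    (src dst : E → V) (s t : H → V) (d : H → ℝ) (u : E → ℝ) : Prop :=
  ∃ f, IsRouting src dst s t d u f


/-- The set of reservations under which every demand vector of `D` is routable
(dynamic routing). -/
def Uset {V E H : Type*} [Fintype E] [Fintype H] [DecidableEq V]
    (src dst : E → V) (s t : H → V) (D : Set (H → ℝ)) : Set (E → ℝ) :=
  {u | (∀ e, 0 ≤ u e) ∧ ∀ d ∈ D, Routable src dst s t d u}

/-- A static routing template: for every commodity `h`, a nonnegative flow
`x h` shipping one unit from `s h` to `t h`. -/
def IsUnitTemplate {V E H : Type*} [Fintype E] [DecidableEq V]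
    (src dst : E → V) (s t : H → V) (x : H → E → Bool → ℝ) : Prop :=
  (∀ h e b, 0 ≤ x h e b) ∧
  (∀ h v, v ≠ s h → v ≠ t h → netOut src dst (x h) v = 0) ∧
  (∀ h, netOut src dst (x h) (s h) = 1)

/-- The set of reservations within which some static routing template serves
every demand vector of `D`: the flow of commodity `h` is `d h • x h`, and for
every edge `e` and every `d ∈ D` the total flow on `e` is at most `u e`. -/
def UsetStat {V E H : Type*} [Fintype E] [Fintype H] [DecidableEq V]
    (src dst : E → V) (s t : H → V) (D : Set (H → ℝ)) : Set (E → ℝ) :=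
  {u | (∀ e, 0 ≤ u e) ∧ ∃ x, IsUnitTemplate src dst s t x ∧
    ∀ d ∈ D, ∀ e, (∑ h, d h * (x h e true + x h e false)) ≤ u e}

/-! ### Generalities on flows -/

section Flow

variable {V E H V' E' H' : Type*} [Fintype E] [Fintype H] [DecidableEq V]
  [Fintype E'] [Fintype H'] [DecidableEq V']

theorem sum_mul_netOut [Fintype V] (src dst : E → V) (f : E → Bool → ℝ) (ψ : V → ℝ) :
    ∑ v, ψ v * netOut src dst f v =
      ∑ e, (ψ (src e) - ψ (dst e)) * (f e true - f e false) := by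
  simp only [netOut, Finset.mul_sum]
  rw [Finset.sum_comm]
  refine Finset.sum_congr rfl fun e _ => ?_
  simp only [mul_add, mul_ite, mul_zero, Finset.sum_add_distrib, Finset.sum_ite_eq,
    Finset.mem_univ, if_true]
  ring

/-- A potential vanishing at the sink bounds from below the weighted length of a flow. -/
theorem potential_mul_le [Fintype V] (src dst : E → V) {f : E → Bool → ℝ} {s t : V} {d : ℝ} {ψ : V → ℝ}
    {c : E → ℝ} (hf : ∀ e b, 0 ≤ f e b)
    (hcons : ∀ v, v ≠ s → v ≠ t → netOut src dst f v = 0) (hs : netOut src dst f s = d)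
    (ht : ψ t = 0) (hc : ∀ e, |ψ (src e) - ψ (dst e)| ≤ c e) :
    ψ s * d ≤ ∑ e, c e * (f e true + f e false) := by
  have h1 : ∑ v, ψ v * netOut src dst f v = ψ s * d := by
    rw [Finset.sum_eq_single s, hs]
    · intro v _ hv
      by_cases hvt : v = t
      · rw [hvt, ht, zero_mul]
      · rw [hcons v hv hvt, mul_zero]
    · simp
  rw [← h1, sum_mul_netOut]
  refine Finset.sum_le_sum fun e _ => ?_
  have h2 : |f e true - f e false| ≤ f e true + f e false := by
    rw [abs_le]
    constructor <;> linarith [hf e true, hf e false]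
  calc _ ≤ |(ψ (src e) - ψ (dst e)) * (f e true - f e false)| := le_abs_self _
    _ = |ψ (src e) - ψ (dst e)| * |f e true - f e false| := abs_mul _ _
    _ ≤ _ := mul_le_mul (hc e) h2 (abs_nonneg _) ((abs_nonneg _).trans (hc e))

theorem netOut_add_smul (src dst : E → V) (f g : E → Bool → ℝ) (a b : ℝ) (v : V) :
    netOut src dst (fun e i => a * f e i + b * g e i) v =
      a * netOut src dst f v + b * netOut src dst g v := by
  simp only [netOut, Finset.mul_sum, ← Finset.sum_add_distrib]
  refine Finset.sum_congr rfl fun e _ => ?_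
  split_ifs <;> ring

theorem convex_routable (src dst : E → V) (s t : H → V) (u : E → ℝ) :
    Convex ℝ {d | Routable src dst s t d u} := by
  rintro d₁ ⟨f, hf0, hfc, hfs, hfu⟩ d₂ ⟨g, hg0, hgc, hgs, hgu⟩ a b ha hb hab
  refine ⟨fun h e i => a * f h e i + b * g h e i, fun h e i => ?_, fun h v hs ht => ?_,
    fun h => ?_, fun e => ?_⟩
  · have := hf0 h e i
    have := hg0 h e i
    positivity
  · rw [netOut_add_smul, hfc h v hs ht, hgc h v hs ht]
    simp
  · rw [netOut_add_smul, hfs, hgs]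
    simp
  · calc _ = a * (∑ h, (f h e true + f h e false)) + b * ∑ h, (g h e true + g h e false) := by
          simp only [Finset.mul_sum, ← Finset.sum_add_distrib]
          exact Finset.sum_congr rfl fun h _ => by ring
      _ ≤ a * u e + b * u e := by gcongr <;> simp [*]
      _ = u e := by rw [← add_mul, hab, one_mul]

/-! ### Transport along reindexings -/

theorem netOut_reindex (eV : V ≃ V') (eE : E ≃ E') (src dst : E → V) (f : E' → Bool → ℝ) (v : V) :
    netOut (eV ∘ src ∘ eE.symm) (eV ∘ dst ∘ eE.symm) f (eV v) =
      netOut src dst (f ∘ eE) v := by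
  simp only [netOut]
  rw [← eE.sum_comp]
  simp

theorem mem_Uset_reindex (eV : V ≃ V') (eE : E ≃ E') (eH : H ≃ H') (src dst : E → V)
    (s t : H → V) (D : Set (H → ℝ)) (u : E' → ℝ) :
    u ∈ Uset (eV ∘ src ∘ eE.symm) (eV ∘ dst ∘ eE.symm) (eV ∘ s ∘ eH.symm) (eV ∘ t ∘ eH.symm)
        ((fun d => d ∘ eH) ⁻¹' D) ↔ u ∘ eE ∈ Uset src dst s t D := by
  constructor
  · rintro ⟨h0, hr⟩
    refine ⟨fun e => h0 _, fun d hd => ?_⟩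
    obtain ⟨f, hf0, hfc, hfs, hfu⟩ := hr (d ∘ eH.symm)
      (by simpa [Function.comp_assoc] using hd)
    refine ⟨fun h => f (eH h) ∘ eE, fun h e b => hf0 _ _ _, fun h v hs ht => ?_, fun h => ?_,
      fun e => ?_⟩
    · rw [← netOut_reindex eV eE]
      exact hfc _ _ (by simpa using hs) (by simpa using ht)
    · rw [← netOut_reindex eV eE]
      simpa using hfs (eH h)
    · have := hfu (eE e)
      rwa [← eH.sum_comp] at this
  · rintro ⟨h0, hr⟩
    refine ⟨fun e => by simpa using h0 (eE.symm e), fun d hd => ?_⟩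
    obtain ⟨f, hf0, hfc, hfs, hfu⟩ := hr (d ∘ eH) hd
    refine ⟨fun h => f (eH.symm h) ∘ eE.symm, fun h e b => hf0 _ _ _, fun h v hs ht => ?_,
      fun h => ?_, fun e => ?_⟩
    · obtain ⟨v, rfl⟩ := eV.surjective v
      rw [netOut_reindex eV eE, Function.comp_assoc, eE.symm_comp_self]
      exact hfc _ _ (by simpa using hs) (by simpa using ht)
    · simp only [Function.comp_apply]
      rw [netOut_reindex eV eE, Function.comp_assoc, eE.symm_comp_self]
      simpa using hfs (eH.symm h)
    · have := hfu (eE.symm e)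
      rw [← eH.symm.sum_comp] at this
      simpa using this

theorem mem_UsetStat_reindex (eV : V ≃ V') (eE : E ≃ E') (eH : H ≃ H') (src dst : E → V)
    (s t : H → V) (D : Set (H → ℝ)) (u : E' → ℝ) :
    u ∈ UsetStat (eV ∘ src ∘ eE.symm) (eV ∘ dst ∘ eE.symm) (eV ∘ s ∘ eH.symm)
        (eV ∘ t ∘ eH.symm) ((fun d => d ∘ eH) ⁻¹' D) ↔ u ∘ eE ∈ UsetStat src dst s t D := by
  constructor
  · rintro ⟨h0, f, ⟨hf0, hfc, hfs⟩, hfu⟩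
    refine ⟨fun e => h0 _, fun h => f (eH h) ∘ eE, ⟨fun h e b => hf0 _ _ _,
      fun h v hs ht => ?_, fun h => ?_⟩, fun d hd e => ?_⟩
    · rw [← netOut_reindex eV eE]
      exact hfc _ _ (by simpa using hs) (by simpa using ht)
    · rw [← netOut_reindex eV eE]
      simpa using hfs (eH h)
    · have := hfu (d ∘ eH.symm) (by simpa [Function.comp_assoc] using hd) (eE e)
      rw [← eH.sum_comp] at this
      simpa using this
  · rintro ⟨h0, f, ⟨hf0, hfc, hfs⟩, hfu⟩
    refine ⟨fun e => by simpa using h0 (eE.symm e), fun h => f (eH.symm h) ∘ eE.symm,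
      ⟨fun h e b => hf0 _ _ _, fun h v hs ht => ?_, fun h => ?_⟩, fun d hd e => ?_⟩
    · obtain ⟨v, rfl⟩ := eV.surjective v
      rw [netOut_reindex eV eE, Function.comp_assoc, eE.symm_comp_self]
      exact hfc _ _ (by simpa using hs) (by simpa using ht)
    · simp only [Function.comp_apply]
      rw [netOut_reindex eV eE, Function.comp_assoc, eE.symm_comp_self]
      simpa using hfs (eH.symm h)
    · have := hfu (d ∘ eH) hd (eE.symm e)
      rw [← eH.symm.sum_comp] at this
      simpa using this

theorem image_cost_reindex (eE : E ≃ E') (lam : E → ℝ) {S : Set (E → ℝ)} {S' : Set (E' → ℝ)}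
    (hS : ∀ u, u ∈ S' ↔ u ∘ eE ∈ S) :
    (fun u : E' → ℝ => ∑ e, (lam ∘ eE.symm) e * u e) '' S' =
      (fun u : E → ℝ => ∑ e, lam e * u e) '' S := by
  ext c
  constructor
  · rintro ⟨u, hu, rfl⟩
    refine ⟨u ∘ eE, (hS u).1 hu, ?_⟩
    simp [← eE.sum_comp]
  · rintro ⟨u, hu, rfl⟩
    refine ⟨u ∘ eE.symm, (hS _).2 (by simpa [Function.comp_assoc] using hu), ?_⟩
    simp [← eE.sum_comp]

end Flow

/-! ### The cube with a root -/

namespace RootedCube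

open scoped symmDiff

variable {ι : Type*} [DecidableEq ι]

/-- Edges of the rooted cube start at a vertex of the cube. -/
def src (e : Finset ι × Option ι) : Option (Finset ι) := some e.1

/-- The edge `(x, some i)` flips the coordinate `i` of `x`; the edge `(x, none)` joins `x` to the
root `none`. -/
def dst (e : Finset ι × Option ι) : Option (Finset ι) := e.2.map fun i => e.1 ∆ {i}

/-- The cost per unit of reservation: `R` for an edge to the root, `1` for an edge of the cube. -/
def cost (R : ℕ) (e : Finset ι × Option ι) : ℝ := e.2.elim (R : ℝ) fun _ => 1

/-- The demand vector of the Hamming ball of radius `R` around `x`. -/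
def ball (R : ℕ) (x v : Finset ι) : ℝ := if (x ∆ v).card ≤ R then 1 else 0

/-- The demand polytope spanned by the Hamming balls of radius `R`. -/
def demands (R : ℕ) : Set (Finset ι → ℝ) := convexHull ℝ (Set.range (ball R))

/-- The potential decreasing from `R` at `v` to `0` outside the ball around `v`. -/
def potential (R : ℕ) (v : Finset ι) (w : Option (Finset ι)) : ℝ :=
  w.elim 0 fun w => ((R - (w ∆ v).card : ℕ) : ℝ)

theorem card_symmDiff_singleton (w : Finset ι) (i : ι) :
    (w ∆ {i}).card ≤ w.card + 1 ∧ w.card ≤ (w ∆ {i}).card + 1 := by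
  have key : ∀ a : Finset ι, (a ∆ {i}).card ≤ a.card + 1 := fun a => by
    have h : a ∆ {i} ⊆ insert i a := fun j hj => by
      simp only [Finset.mem_symmDiff, Finset.mem_singleton, Finset.mem_insert] at hj ⊢
      tauto
    exact (Finset.card_le_card h).trans (Finset.card_insert_le _ _)
  exact ⟨key w, by simpa using key (w ∆ {i})⟩

theorem abs_potential_sub_le (R : ℕ) (v : Finset ι) (e : Finset ι × Option ι) :
    |potential R v (src e) - potential R v (dst e)| ≤ cost R e * ball R e.1 v := by
  obtain ⟨x, _ | i⟩ := e
  · simp only [potential, src, dst, cost, ball, Option.map_none, Option.elim]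
    split_ifs with h
    · simp
    · rw [Nat.sub_eq_zero_of_le (by omega)]
      simp
  · simp only [potential, src, dst, cost, ball, Option.map_some, Option.elim]
    have h := card_symmDiff_singleton (x ∆ v) i
    rw [symmDiff_right_comm] at h
    obtain ⟨h1, h2⟩ := h
    split_ifs with h
    · rw [mul_one, abs_le]
      constructor
      · have : R - (x ∆ {i} ∆ v).card ≤ R - (x ∆ v).card + 1 := by omega
        have : ((R - (x ∆ {i} ∆ v).card : ℕ) : ℝ) ≤ (R - (x ∆ v).card : ℕ) + 1 := by
          exact_mod_cast this
        linarith
      · have : R - (x ∆ v).card ≤ R - (x ∆ {i} ∆ v).card + 1 := by omega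
        have : ((R - (x ∆ v).card : ℕ) : ℝ) ≤ (R - (x ∆ {i} ∆ v).card : ℕ) + 1 := by
          exact_mod_cast this
        linarith
    · rw [Nat.sub_eq_zero_of_le (by omega), Nat.sub_eq_zero_of_le (by omega)]
      simp

theorem ball_nonneg (R : ℕ) (x v : Finset ι) : 0 ≤ ball R x v := by
  unfold ball
  split_ifs <;> norm_num

theorem ball_le_one (R : ℕ) (x v : Finset ι) : ball R x v ≤ 1 := by
  unfold ball
  split_ifs <;> norm_num

omit [DecidableEq ι] in
theorem cost_nonneg (R : ℕ) (e : Finset ι × Option ι) : 0 ≤ cost R e := by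
  obtain ⟨x, _ | i⟩ := e <;> simp [cost]

theorem ball_mem_demands (R : ℕ) (x : Finset ι) : ball R x ∈ demands R :=
  subset_convexHull ℝ _ ⟨x, rfl⟩

theorem demands_subset_Icc (R : ℕ) : demands R ⊆ Set.Icc (0 : Finset ι → ℝ) 1 := by
  refine convexHull_min ?_ (convex_Icc _ _)
  rintro _ ⟨x, rfl⟩
  exact ⟨fun v => ball_nonneg R x v, fun v => ball_le_one R x v⟩

/-- Auxiliary to `mass`, by recursion on the cardinality of `w`: the walk started at `v` reaches
`w` from `w.erase i` with probability `1 / (L - k)`, where `k` is the cardinality of `w.erase i`. -/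
noncomputable def massAux (L : ℕ) (v : Finset ι) : ℕ → Finset ι → ℝ
  | 0, w => if w = v then 1 else 0
  | k + 1, w => (if w = v then 1 else 0) + ∑ i ∈ w, massAux L v k (w.erase i) / ((L : ℝ) - k)

/-- The probability that the walk which starts at `v` and adds a uniformly random missing element
at each step passes through `w`. -/
noncomputable def mass (L : ℕ) (v w : Finset ι) : ℝ := massAux L v w.card w

theorem mass_eq (L : ℕ) (v w : Finset ι) :
    mass L v w = (if w = v then 1 else 0) +
      ∑ i ∈ w, mass L v (w.erase i) / ((L : ℝ) - (w.erase i).card) := by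
  unfold mass
  rcases hk : w.card with _ | k
  · rw [Finset.card_eq_zero] at hk
    subst hk
    simp [massAux]
  · simp only [massAux]
    congr 1
    refine Finset.sum_congr rfl fun i hi => ?_
    rw [Finset.card_erase_of_mem hi, hk]
    rfl

variable [Fintype ι]

omit [DecidableEq ι] in
theorem cast_card_le (w : Finset ι) : (w.card : ℝ) ≤ Fintype.card ι := by
  exact_mod_cast Finset.card_le_univ w

theorem mass_nonneg (v w : Finset ι) : 0 ≤ mass (Fintype.card ι) v w := by
  induction hk : w.card generalizing w with
  | zero =>
    rw [Finset.card_eq_zero] at hk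
    subst hk
    rw [mass_eq]
    simp only [Finset.sum_empty, add_zero]
    split_ifs <;> norm_num
  | succ k ih =>
    rw [mass_eq]
    refine add_nonneg (by split_ifs <;> norm_num) (Finset.sum_nonneg fun i hi => ?_)
    exact div_nonneg (ih _ (by rw [Finset.card_erase_of_mem hi, hk]; rfl))
      (sub_nonneg.2 (cast_card_le _))

theorem sum_mass_eq (L R : ℕ) (w : Finset ι) :
    ∑ v, ball R ∅ v * mass L v w = ball R ∅ w +
      ∑ i ∈ w, (∑ v, ball R ∅ v * mass L v (w.erase i)) / ((L : ℝ) - (w.erase i).card) := by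
  simp_rw [Finset.sum_div]
  rw [Finset.sum_comm]
  have : ball R ∅ w = ∑ v : Finset ι, ball R ∅ v * if w = v then 1 else 0 := by simp
  rw [this, ← Finset.sum_add_distrib]
  refine Finset.sum_congr rfl fun v _ => ?_
  rw [mass_eq L v w, mul_add, Finset.mul_sum]
  simp only [mul_div_assoc]

/-- The total mass started in a Hamming ball stays bounded inside the ball, and decays
geometrically outside. -/
theorem sum_mass_le {R : ℕ} (hL : Fintype.card ι = 8 * R) (w : Finset ι) (hw : w.card ≤ 2 * R) :
    (∑ v, ball R ∅ v * mass (Fintype.card ι) v w) * 3 ^ (w.card - R) ≤ 2 := by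
  induction hk : w.card generalizing w with
  | zero =>
    rw [Finset.card_eq_zero] at hk
    subst hk
    rw [sum_mass_eq]
    simp [ball]
  | succ k ih =>
    rw [sum_mass_eq]
    have hR : (k : ℝ) + 1 ≤ 2 * R := by
      rw [hk] at hw
      exact_mod_cast hw
    have hpos : (0 : ℝ) < 8 * R - k := by
      have : (0 : ℝ) ≤ k := k.cast_nonneg
      linarith
    have hstep : ∑ i ∈ w, (∑ v, ball R ∅ v * mass (Fintype.card ι) v (w.erase i)) /
        (((Fintype.card ι : ℕ) : ℝ) - (w.erase i).card) ≤ (2 / 3 ^ (k - R)) / 3 := by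
      calc _ ≤ ∑ i ∈ w, (2 / 3 ^ (k - R)) / (8 * R - k : ℝ) := by
            refine Finset.sum_le_sum fun i hi => ?_
            have hc : (w.erase i).card = k := by
              rw [Finset.card_erase_of_mem hi, hk]
              rfl
            have := ih (w.erase i) (by omega) hc
            rw [hc, hL]
            push_cast
            rw [← le_div_iff₀ (by positivity), hL] at this
            gcongr
        _ = (2 / 3 ^ (k - R)) * ((k + 1) / (8 * R - k : ℝ)) := by
            rw [Finset.sum_const, hk, nsmul_eq_mul]
            push_cast
            ring
        _ ≤ (2 / 3 ^ (k - R)) * (1 / 3) := by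
            refine mul_le_mul_of_nonneg_left ?_ (by positivity)
            rw [div_le_div_iff₀ hpos (by norm_num)]
            linarith
        _ = _ := by ring
    by_cases hkR : k + 1 ≤ R
    · rw [Nat.sub_eq_zero_of_le hkR]
      rw [Nat.sub_eq_zero_of_le (by omega)] at hstep
      have := ball_le_one R ∅ w
      linarith
    · have h0 : ball R ∅ w = 0 := by
        simp only [ball, Finset.bot_eq_empty.symm, bot_symmDiff]
        rw [if_neg (by omega)]
      rw [h0, zero_add, Nat.sub_add_comm (by omega), pow_succ]
      calc _ ≤ (2 / 3 ^ (k - R)) / 3 * (3 ^ (k - R) * 3 : ℝ) := by gcongr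
        _ = 2 := by field_simp

theorem netOut_some (f : Finset ι × Option ι → Bool → ℝ) (w : Finset ι) :
    netOut src dst f (some w) = (f (w, none) true - f (w, none) false) +
      ∑ i, ((f (w, some i) true - f (w, some i) false) +
        (f (w ∆ {i}, some i) false - f (w ∆ {i}, some i) true)) := by
  have hflip : ∀ (x : Finset ι) i, x ∆ {i} = w ↔ x = w ∆ {i} := fun x i => by
    constructor
    · rintro rfl
      simp
    · rintro rfl
      simp
  simp only [netOut, src, dst, Fintype.sum_prod_type, Fintype.sum_option, Option.map_none,
    Option.map_some, Option.some.injEq, reduceCtorEq, if_false, hflip,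
    Finset.sum_add_distrib]
  rw [Finset.sum_comm (s := Finset.univ) (t := Finset.univ)
      (f := fun x i => if x = w then f (x, some i) true - f (x, some i) false else 0),
    Finset.sum_comm (s := Finset.univ) (t := Finset.univ)
      (f := fun x i => if x = w ∆ {i} then f (x, some i) false - f (x, some i) true else 0)]
  simp [add_assoc]

/-- The upward random walk from `v`, sent to the root when it reaches level `2 * R`. -/
noncomputable def upFlow (R : ℕ) (v : Finset ι) (w : Finset ι) : Option ι → ℝ
  | none => if w.card = 2 * R then mass (Fintype.card ι) v w else 0
  | some i => if i ∉ w ∧ w.card < 2 * R then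
      mass (Fintype.card ι) v w / ((Fintype.card ι : ℝ) - w.card) else 0

theorem upFlow_nonneg (R : ℕ) (v w : Finset ι) (o : Option ι) : 0 ≤ upFlow R v w o := by
  rcases o with _ | i <;> simp only [upFlow] <;> split_ifs
  · exact mass_nonneg v w
  · rfl
  · exact div_nonneg (mass_nonneg v w) (sub_nonneg.2 (cast_card_le _))
  · rfl

theorem upFlow_balance {R : ℕ} (hL : Fintype.card ι = 8 * R) {v : Finset ι} (hv : v.card ≤ R)
    (w : Finset ι) :
    upFlow R v w none + ∑ i, (upFlow R v w (some i) - upFlow R v (w ∆ {i}) (some i)) =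
      if w = v then 1 else 0 := by
  have hin : ∑ i, upFlow R v (w ∆ {i}) (some i) = if w.card ≤ 2 * R then
      ∑ i ∈ w, mass (Fintype.card ι) v (w.erase i) /
        ((Fintype.card ι : ℝ) - (w.erase i).card) else 0 := by
    rw [← Finset.sum_filter_add_sum_filter_not Finset.univ (· ∈ w)]
    have h2 : ∀ i ∈ Finset.univ.filter (fun i => ¬ i ∈ w),
        upFlow R v (w ∆ {i}) (some i) = 0 := fun i hi => by
      have hi : i ∉ w := by simpa using hi
      simp [upFlow, Finset.mem_symmDiff, hi]
    rw [Finset.sum_eq_zero h2, add_zero]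
    have h3 : Finset.univ.filter (· ∈ w) = w := by ext; simp
    rw [h3]
    have h1 : ∀ i ∈ w, w ∆ {i} = w.erase i := fun i hi => by
      ext j
      simp only [Finset.mem_symmDiff, Finset.mem_singleton, Finset.mem_erase]
      by_cases hj : j = i
      · subst hj
        simp [hi]
      · simp [hj]
    split_ifs with hw
    · refine Finset.sum_congr rfl fun i hi => ?_
      have := Finset.card_erase_lt_of_mem hi
      rw [h1 i hi, upFlow, if_pos ⟨by simp, by omega⟩]
    · refine Finset.sum_eq_zero fun i hi => ?_
      have := Finset.card_erase_of_mem hi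
      rw [h1 i hi, upFlow, if_neg (by omega)]
  rw [Finset.sum_sub_distrib, hin]
  have hout : ∑ i, upFlow R v w (some i) =
      if w.card < 2 * R then mass (Fintype.card ι) v w else 0 := by
    split_ifs with hw
    · simp only [upFlow, hw, and_true]
      rw [← Finset.sum_filter, Finset.sum_const, nsmul_eq_mul]
      have h3 : Finset.univ.filter (fun i => i ∉ w) = wᶜ := by ext; simp
      rw [h3, Finset.card_compl, Nat.cast_sub (Finset.card_le_univ w)]
      have : (0 : ℝ) < (Fintype.card ι : ℝ) - w.card := by
        rw [sub_pos, Nat.cast_lt]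
        omega
      field_simp
    · exact Finset.sum_eq_zero fun i _ => by simp [upFlow, hw]
  rw [hout, upFlow]
  rcases lt_trichotomy w.card (2 * R) with h | h | h
  · rw [if_neg (by omega), if_pos h, if_pos h.le, mass_eq]
    ring
  · rw [if_pos h, if_neg (by omega), if_pos h.le, mass_eq]
    ring
  · rw [if_neg (by omega), if_neg (by omega), if_neg (by omega), if_neg]
    · ring
    · rintro rfl
      omega

/-- A reservation of low cost under which every ball of radius `R` is routable. -/
noncomputable def reservation (R : ℕ) (e : Finset ι × Option ι) : ℝ :=
  e.2.elim (1 / (R : ℝ)) fun _ => 1 / (3 * R)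

omit [DecidableEq ι] [Fintype ι] in
theorem reservation_nonneg (R : ℕ) (e : Finset ι × Option ι) : 0 ≤ reservation R e := by
  obtain ⟨x, _ | i⟩ := e <;> simp only [reservation, Option.elim] <;> positivity

theorem sum_upFlow_le {R : ℕ} (hR : 0 < R) (hL : Fintype.card ι = 8 * R) (x w : Finset ι)
    (o : Option ι) : ∑ v, ball R ∅ v * upFlow R v w o ≤ reservation R (x, o) := by
  have hR' : (0 : ℝ) < R := by exact_mod_cast hR
  rcases o with _ | i
  · simp only [upFlow, reservation, Option.elim]
    split_ifs with hw
    · have := sum_mass_le hL w hw.le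
      rw [hw, two_mul, Nat.add_sub_cancel] at this
      have h3 : (2 * R : ℝ) ≤ 3 ^ R := by
        have : 2 * R ≤ 3 ^ R := by
          clear * - hR
          induction R, hR using Nat.le_induction with
          | base => norm_num
          | succ n hn ih =>
            rw [pow_succ]
            have : 0 < n := hn
            omega
        exact_mod_cast this
      rw [le_div_iff₀ hR']
      have h0 : 0 ≤ ∑ v, ball R ∅ v * mass (Fintype.card ι) v w :=
        Finset.sum_nonneg fun v _ => mul_nonneg (ball_nonneg _ _ _) (mass_nonneg v w)
      nlinarith
    · simp
  · simp only [upFlow, reservation, Option.elim]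
    split_ifs with hw
    · have hM := sum_mass_le hL w hw.2.le
      have h0 : 0 ≤ ∑ v, ball R ∅ v * mass (Fintype.card ι) v w :=
        Finset.sum_nonneg fun v _ => mul_nonneg (ball_nonneg _ _ _) (mass_nonneg v w)
      have h1 : (1 : ℝ) ≤ 3 ^ (w.card - R) := one_le_pow₀ (by norm_num)
      have hM2 : ∑ v, ball R ∅ v * mass (Fintype.card ι) v w ≤ 2 :=
        (le_mul_of_one_le_right h0 h1).trans hM
      simp_rw [← mul_div_assoc]
      rw [← Finset.sum_div]
      have hw2 : (w.card : ℝ) ≤ 2 * R := by exact_mod_cast hw.2.le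
      have hc : ((Fintype.card ι : ℕ) : ℝ) = 8 * R := by
        rw [hL]
        push_cast
        ring
      calc _ ≤ 2 / (6 * R : ℝ) := by
            refine div_le_div₀ (by norm_num) hM2 (by positivity) ?_
            linarith
        _ = _ := by
            field_simp
            norm_num
    · simp only [mul_zero, Finset.sum_const_zero]
      positivity

theorem ball_eq_translate (R : ℕ) (x v : Finset ι) : ball R x v = ball R ∅ (v ∆ x) := by
  simp only [ball, Finset.bot_eq_empty.symm, bot_symmDiff, symmDiff_comm x v]

theorem routable_ball {R : ℕ} (hR : 0 < R) (hL : Fintype.card ι = 8 * R) (x : Finset ι) :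
    Routable src dst some (fun _ => none) (ball R x) (reservation R) := by
  have key : ∀ v w : Finset ι, netOut src dst (fun (e : Finset ι × Option ι) (b : Bool) =>
      if b then ball R x v * upFlow R (v ∆ x) (e.1 ∆ x) e.2 else 0) (some w) =
        ball R x v * if w = v then 1 else 0 := by
    intro v w
    rw [netOut_some]
    simp only [if_true, Bool.false_eq_true, if_false, sub_zero, zero_sub]
    by_cases hv : (x ∆ v).card ≤ R
    · have := upFlow_balance hL (v := v ∆ x) (by rwa [symmDiff_comm]) (w ∆ x)
      simp only [symmDiff_left_inj] at this
      rw [← this, mul_add, Finset.mul_sum]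
      congr 1
      refine Finset.sum_congr rfl fun i _ => ?_
      rw [symmDiff_right_comm w {i} x]
      ring
    · have : ball R x v = 0 := if_neg hv
      simp [this]
  refine ⟨fun v e b => if b then ball R x v * upFlow R (v ∆ x) (e.1 ∆ x) e.2 else 0,
    fun v e b => ?_, fun v w hs ht => ?_, fun v => ?_, fun e => ?_⟩
  · dsimp only
    split_ifs
    · exact mul_nonneg (ball_nonneg _ _ _) (upFlow_nonneg _ _ _ _)
    · rfl
  · rcases w with _ | w
    · exact absurd rfl ht
    · rw [key, if_neg (fun h => hs (by rw [h])), mul_zero]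
  · rw [key, if_pos rfl, mul_one]
  · simp only [if_true, Bool.false_eq_true, if_false, add_zero, ball_eq_translate R x]
    have hinv : Function.Involutive fun v : Finset ι => v ∆ x := fun v => by simp
    exact (Equiv.sum_comp hinv.toPerm fun v => ball R ∅ v * upFlow R v (e.1 ∆ x) e.2).trans_le
      (sum_upFlow_le hR hL e.1 _ _)

theorem reservation_mem_Uset {R : ℕ} (hR : 0 < R) (hL : Fintype.card ι = 8 * R) :
    reservation R ∈ Uset src dst (some : Finset ι → _) (fun _ => none) (demands R) := by
  refine ⟨reservation_nonneg R, fun d hd => ?_⟩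
  refine convexHull_min ?_ (convex_routable src dst some (fun _ => none) (reservation R)) hd
  rintro _ ⟨x, rfl⟩
  exact routable_ball hR hL x

omit [DecidableEq ι] in
theorem sum_cost_reservation_le {R : ℕ} (hR : 0 < R) (hL : Fintype.card ι = 8 * R) :
    ∑ e : Finset ι × Option ι, cost R e * reservation R e ≤
      4 * (Fintype.card (Finset ι) : ℝ) := by
  have hR' : (0 : ℝ) < R := by exact_mod_cast hR
  simp only [Fintype.sum_prod_type, Fintype.sum_option, cost, reservation, Option.elim,
    Finset.sum_const, Finset.card_univ, nsmul_eq_mul, hL]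
  rw [mul_comm 4]
  gcongr
  push_cast
  field_simp
  norm_num

theorem le_sum_cost_of_mem_Uset (R : ℕ) {u : Finset ι × Option ι → ℝ}
    (hu : u ∈ Uset src dst some (fun _ => none) (demands R)) : (R : ℝ) ≤ ∑ e, cost R e * u e := by
  obtain ⟨f, hf0, hfc, hfs, hfu⟩ := hu.2 _ (ball_mem_demands R (∅ : Finset ι))
  have h := potential_mul_le src dst (ψ := potential R (∅ : Finset ι)) (hf0 ∅) (hfc ∅) (hfs ∅) rfl
    (abs_potential_sub_le R ∅)
  have h1 : potential R ∅ (some (∅ : Finset ι)) * ball R ∅ (∅ : Finset ι) = R := by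
    simp [potential, ball]
  rw [h1] at h
  refine h.trans (Finset.sum_le_sum fun e _ => ?_)
  have hle : f ∅ e true + f ∅ e false ≤ u e :=
    (Finset.single_le_sum (f := fun h => f h e true + f h e false)
      (fun h _ => add_nonneg (hf0 h e true) (hf0 h e false)) (Finset.mem_univ ∅)).trans (hfu e)
  have hb : cost R e * ball R e.1 ∅ ≤ cost R e :=
    mul_le_of_le_one_right (cost_nonneg R e) (ball_le_one R _ _)
  exact mul_le_mul hb hle (add_nonneg (hf0 _ e true) (hf0 _ e false)) (cost_nonneg R e)

theorem le_sum_cost_of_mem_UsetStat (R : ℕ) {u : Finset ι × Option ι → ℝ}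
    (hu : u ∈ UsetStat src dst some (fun _ => none) (demands R)) :
    (R : ℝ) * Fintype.card (Finset ι) ≤ ∑ e, cost R e * u e := by
  obtain ⟨-, f, ⟨hf0, hfc, hfs⟩, hfu⟩ := hu
  have h : ∀ v : Finset ι,
      (R : ℝ) ≤ ∑ e, cost R e * (ball R e.1 v * (f v e true + f v e false)) := fun v => by
    have h := potential_mul_le src dst (ψ := potential R v) (hf0 v) (hfc v) (hfs v) rfl
      (abs_potential_sub_le R v)
    simpa [potential, mul_assoc] using h
  calc (R : ℝ) * Fintype.card (Finset ι) = ∑ _v : Finset ι, (R : ℝ) := by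
        rw [Finset.sum_const, Finset.card_univ, nsmul_eq_mul, mul_comm]
    _ ≤ ∑ v, ∑ e, cost R e * (ball R e.1 v * (f v e true + f v e false)) :=
        Finset.sum_le_sum fun v _ => h v
    _ = ∑ e, cost R e * ∑ v, ball R e.1 v * (f v e true + f v e false) := by
        rw [Finset.sum_comm]
        simp only [Finset.mul_sum]
    _ ≤ _ := Finset.sum_le_sum fun e _ =>
        mul_le_mul_of_nonneg_left (hfu _ (ball_mem_demands R e.1) e) (cost_nonneg R e)

theorem UsetStat_nonempty (R : ℕ) :
    (UsetStat src dst (some : Finset ι → _) (fun _ => none) (demands R)).Nonempty := by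
  have key : ∀ v w : Finset ι, netOut src dst (fun (e : Finset ι × Option ι) (b : Bool) =>
      if e = (v, none) ∧ b = true then (1 : ℝ) else 0) (some w) = if w = v then 1 else 0 := by
    intro v w
    rw [netOut_some]
    simp
  refine ⟨fun _ => Fintype.card (Finset ι), fun _ => by positivity,
    fun v e b => if e = (v, none) ∧ b = true then 1 else 0, ⟨fun v e b => ?_,
    fun v w hs ht => ?_, fun v => ?_⟩, fun d hd e => ?_⟩
  · dsimp only
    split_ifs <;> norm_num
  · rcases w with _ | w
    · exact absurd rfl ht
    · rw [key, if_neg (fun h => hs (by rw [h]))]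
  · rw [key, if_pos rfl]
  · calc _ ≤ ∑ _v : Finset ι, (1 : ℝ) := by
          refine Finset.sum_le_sum fun v _ => ?_
          have h0 := (demands_subset_Icc R hd).1 v
          have h1 := (demands_subset_Icc R hd).2 v
          simp only [Pi.zero_apply, Pi.one_apply] at h0 h1
          by_cases he : e = (v, none) <;> simp [he, h1]
      _ = _ := by simp

end RootedCube

/-- **The optimal static (oblivious) fractional solution can be `Ω(log n)`
times more expensive than the optimal dynamic fractional solution when a
linear reservation cost is minimized.**  There is a constant `k > 0` such that
for every `N` there is an instance — a finite undirected graph with `nV ≥ N`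
vertices (encoded by edge-endpoint maps `src, dst : Fin nE → Fin nV`), a finite
commodity set with endpoints `s, t`, a nonempty compact convex demand polytope
`D ⊆ ℝ_{≥0}^H`, and a nonnegative cost vector `lam` — whose optimal dynamic
linear reservation cost is positive and whose optimal static linear reservation
cost is at least `k · log nV` times larger. -/
theorem static_dynamic_linear_cost_gap :
    ∃ k : ℝ, 0 < k ∧ ∀ N : ℕ, ∃ (nV nE nH : ℕ)
      (src dst : Fin nE → Fin nV) (s t : Fin nH → Fin nV)
      (D : Set (Fin nH → ℝ)) (lam : Fin nE → ℝ),
      N ≤ nV ∧ D.Nonempty ∧ IsCompact D ∧ Convex ℝ D ∧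
      (∀ d ∈ D, ∀ h, 0 ≤ d h) ∧ (∀ e, 0 ≤ lam e) ∧
      0 < sInf ((fun u : Fin nE → ℝ => ∑ e, lam e * u e) '' Uset src dst s t D) ∧
      k * Real.log nV *
          sInf ((fun u : Fin nE → ℝ => ∑ e, lam e * u e) '' Uset src dst s t D) ≤
        sInf ((fun u : Fin nE → ℝ => ∑ e, lam e * u e) '' UsetStat src dst s t D) := by
  refine ⟨1 / 36, by norm_num, fun N => ?_⟩
  set R : ℕ := N + 1
  have hR : 0 < R := N.succ_pos
  have hL : Fintype.card (Fin (8 * R)) = 8 * R := Fintype.card_fin _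
  let X := Finset (Fin (8 * R))
  let eV : Option X ≃ Fin (Fintype.card (Option X)) := Fintype.equivFin _
  let eE : X × Option (Fin (8 * R)) ≃ Fin (Fintype.card (X × Option (Fin (8 * R)))) :=
    Fintype.equivFin _
  let eH : X ≃ Fin (Fintype.card X) := Fintype.equivFin _
  have hcard : Fintype.card X = 2 ^ (8 * R) := by simp [X]
  refine ⟨_, _, _, eV ∘ RootedCube.src ∘ eE.symm, eV ∘ RootedCube.dst ∘ eE.symm,
    eV ∘ some ∘ eH.symm, eV ∘ (fun _ => none) ∘ eH.symm,
    (fun d => d ∘ eH) ⁻¹' RootedCube.demands R, RootedCube.cost R ∘ eE.symm, ?_, ?_, ?_, ?_, ?_,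
    fun e => RootedCube.cost_nonneg R _, ?_⟩
  · rw [Fintype.card_option, hcard]
    have := (8 * R).lt_two_pow_self
    omega
  · exact ⟨RootedCube.ball R ∅ ∘ eH.symm, by
      simpa [Function.comp_assoc] using RootedCube.ball_mem_demands R ∅⟩
  · have hc : IsCompact (RootedCube.demands R : Set (X → ℝ)) :=
      (Set.finite_range _).isCompact_convexHull ℝ
    exact (Homeomorph.piCongrLeft (Y := fun _ => ℝ) eH).symm.isCompact_preimage.2 hc
  · exact (convex_convexHull ℝ _).linear_preimage (LinearMap.funLeft ℝ ℝ eH)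
  · intro d hd h
    simpa using (RootedCube.demands_subset_Icc R hd).1 (eH.symm h)
  rw [image_cost_reindex eE (RootedCube.cost R) (mem_Uset_reindex eV eE eH _ _ _ _ _),
    image_cost_reindex eE (RootedCube.cost R) (mem_UsetStat_reindex eV eE eH _ _ _ _ _)]
  have hR' : (0 : ℝ) < R := by exact_mod_cast hR
  have hmem := RootedCube.reservation_mem_Uset hR hL
  have hlow : (R : ℝ) ≤ sInf ((fun u : X × Option (Fin (8 * R)) → ℝ =>
      ∑ e, RootedCube.cost R e * u e) '' Uset RootedCube.src RootedCube.dst some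
        (fun _ => none) (RootedCube.demands R)) := by
    refine le_csInf ⟨_, _, hmem, rfl⟩ ?_
    rintro _ ⟨u, hu, rfl⟩
    exact RootedCube.le_sum_cost_of_mem_Uset R hu
  have hup : sInf ((fun u : X × Option (Fin (8 * R)) → ℝ =>
      ∑ e, RootedCube.cost R e * u e) '' Uset RootedCube.src RootedCube.dst some
        (fun _ => none) (RootedCube.demands R)) ≤ 4 * (Fintype.card X : ℝ) := by
    refine csInf_le_of_le ⟨R, ?_⟩ ⟨_, hmem, rfl⟩ (RootedCube.sum_cost_reservation_le hR hL)
    rintro _ ⟨u, hu, rfl⟩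
    exact RootedCube.le_sum_cost_of_mem_Uset R hu
  have hstat : (R : ℝ) * Fintype.card X ≤ sInf ((fun u : X × Option (Fin (8 * R)) → ℝ =>
      ∑ e, RootedCube.cost R e * u e) '' UsetStat RootedCube.src RootedCube.dst some
        (fun _ => none) (RootedCube.demands R)) := by
    refine le_csInf ((RootedCube.UsetStat_nonempty R).image _) ?_
    rintro _ ⟨u, hu, rfl⟩
    exact RootedCube.le_sum_cost_of_mem_UsetStat R hu
  have hlog : Real.log (Fintype.card (Option X)) ≤ 9 * R := by
    have h1 : ((Fintype.card (Option X) : ℕ) : ℝ) ≤ 2 ^ (9 * R) := by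
      rw [Fintype.card_option, hcard]
      have h2 : 2 ^ (8 * R) + 1 ≤ 2 ^ (9 * R) := by
        calc 2 ^ (8 * R) + 1 ≤ 2 ^ (8 * R) + 2 ^ (8 * R) :=
              Nat.add_le_add_left Nat.one_le_two_pow _
          _ = 2 ^ (8 * R + 1) := by ring
          _ ≤ 2 ^ (9 * R) := Nat.pow_le_pow_right (by norm_num) (by omega)
      exact_mod_cast h2
    calc Real.log (Fintype.card (Option X)) ≤ Real.log (2 ^ (9 * R)) :=
          Real.log_le_log (by rw [Fintype.card_option]; positivity) h1
      _ = 9 * R * Real.log 2 := by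
          rw [Real.log_pow]
          push_cast
          ring
      _ ≤ 9 * R := mul_le_of_le_one_right (by positivity) (by linarith [Real.log_two_lt_d9])
  refine ⟨hR'.trans_le hlow, le_trans ?_ hstat⟩
  calc _ ≤ (1 / 36 * (9 * R) : ℝ) * (4 * (Fintype.card X : ℝ)) :=
        mul_le_mul (mul_le_mul_of_nonneg_left hlog (by norm_num)) hup (hR'.le.trans hlow)
          (by positivity)
    _ = R * Fintype.card X := by ring
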